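/- There exist functions f, g with vanishing Poisson bracket but nonvanishing generalized Moyal bracket: let n ≥ 1 be the smallest index with a_n ≠ 0 among the coefficients a_1, a_2, … of the generalized Moyal bracket, and let f(q,p) = q^n p^{n+1} on phase space ℝ × ℝ. Then {f, f²} = 0 identically, but ⟦f, f²⟧ = a_n ħ^{2n} (f D_ω^{2n+1} f²) is not identically zero. -/

import Mathlib

/-- Partial derivative in the position variable `q` on phase space `ℝ × ℝ`. -/
noncomputable def dq1 (f : ℝ × ℝ → ℝ) : ℝ × ℝ → ℝ :=
  fun x => fderiv ℝ f x (1, 0)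

/-- Partial derivative in the momentum variable `p` on phase space `ℝ × ℝ`. -/
noncomputable def dp1 (f : ℝ × ℝ → ℝ) : ℝ × ℝ → ℝ :=
  fun x => fderiv ℝ f x (0, 1)

/-- Iterated bidifferential operator on `ℝ × ℝ`: `Dpow1 k f g = f D_ω^k g`, with
`f D_ω^0 g = f·g` and
`f D_ω^{k+1} g = (∂f/∂q) D_ω^k (∂g/∂p) − (∂f/∂p) D_ω^k (∂g/∂q)`. -/
noncomputable def Dpow1 : ℕ → (ℝ × ℝ → ℝ) → (ℝ × ℝ → ℝ) → ℝ × ℝ → ℝ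
  | 0, f, g => fun x => f x * g x
  | k + 1, f, g => fun x => Dpow1 k (dq1 f) (dp1 g) x - Dpow1 k (dp1 f) (dq1 g) x
/-- The generalized Moyal bracket on `ℝ × ℝ`:
`⟦f,g⟧ = ∑_{n=0}^{N₀} a_n ħ^{2n} (f D_ω^{2n+1} g)`, where `hbar` plays the role of `ħ`. -/
noncomputable def gmb1 (a : ℕ → ℝ) (hbar : ℝ) (N₀ : ℕ) (f g : ℝ × ℝ → ℝ) : ℝ × ℝ → ℝ :=
  fun x => ∑ n ∈ Finset.range (N₀ + 1), a n * hbar ^ (2 * n) * Dpow1 (2 * n + 1) f g x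

/-- The monomial function `(q, p) ↦ c q^i p^j` on phase space. -/
def phaseMonomial (c : ℝ) (i j : ℕ) : ℝ × ℝ → ℝ :=
  fun x => c * (x.1 ^ i * x.2 ^ j)

theorem hasFDerivAt_phaseMonomial (c : ℝ) (i j : ℕ) (x : ℝ × ℝ) :
    HasFDerivAt (phaseMonomial c i j)
      (c • (x.1 ^ i • (((j : ℝ) * x.2 ^ (j - 1)) • ContinuousLinearMap.snd ℝ ℝ ℝ) +
        x.2 ^ j • (((i : ℝ) * x.1 ^ (i - 1)) • ContinuousLinearMap.fst ℝ ℝ ℝ))) x := by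
  have hq : HasFDerivAt (fun y : ℝ × ℝ => y.1 ^ i)
      (((i : ℝ) * x.1 ^ (i - 1)) • ContinuousLinearMap.fst ℝ ℝ ℝ) x :=
    (hasDerivAt_pow i x.1).comp_hasFDerivAt x hasFDerivAt_fst
  have hp : HasFDerivAt (fun y : ℝ × ℝ => y.2 ^ j)
      (((j : ℝ) * x.2 ^ (j - 1)) • ContinuousLinearMap.snd ℝ ℝ ℝ) x :=
    (hasDerivAt_pow j x.2).comp_hasFDerivAt x hasFDerivAt_snd
  exact (hq.mul hp).const_mul c

theorem dq1_phaseMonomial (c : ℝ) (i j : ℕ) :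
    dq1 (phaseMonomial c i j) = phaseMonomial (c * i) (i - 1) j := by
  funext x
  simp only [dq1, (hasFDerivAt_phaseMonomial c i j x).fderiv, phaseMonomial]
  simp
  ring

theorem dp1_phaseMonomial (c : ℝ) (i j : ℕ) :
    dp1 (phaseMonomial c i j) = phaseMonomial (c * j) i (j - 1) := by
  funext x
  simp only [dp1, (hasFDerivAt_phaseMonomial c i j x).fderiv, phaseMonomial]
  simp
  ring

theorem phaseMonomial_zero (i j : ℕ) : phaseMonomial 0 i j = fun _ => 0 := by
  funext x
  simp [phaseMonomial]

theorem Dpow1_zero_left (k : ℕ) (g : ℝ × ℝ → ℝ) (x : ℝ × ℝ) :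
    Dpow1 k (fun _ => 0) g x = 0 := by
  induction k generalizing g with
  | zero => simp [Dpow1]
  | succ k ih =>
    have hq : dq1 (fun _ => 0) = fun _ => 0 := by funext y; simp [dq1]
    have hp : dp1 (fun _ => 0) = fun _ => 0 := by funext y; simp [dp1]
    simp only [Dpow1, hq, hp, ih, sub_zero]

/-- `D_ω^k` vanishes once `k` exceeds the degree of the left argument. -/
theorem Dpow1_phaseMonomial_of_lt (k : ℕ) (c : ℝ) (i j : ℕ) (h : i + j < k)
    (g : ℝ × ℝ → ℝ) (x : ℝ × ℝ) : Dpow1 k (phaseMonomial c i j) g x = 0 := by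
  induction k generalizing c i j g with
  | zero => omega
  | succ k ih =>
    have hq : Dpow1 k (dq1 (phaseMonomial c i j)) (dp1 g) x = 0 := by
      rw [dq1_phaseMonomial]
      cases i with
      | zero => simp only [Nat.cast_zero, mul_zero, phaseMonomial_zero, Dpow1_zero_left]
      | succ i => exact ih _ _ _ (by omega) _
    have hp : Dpow1 k (dp1 (phaseMonomial c i j)) (dq1 g) x = 0 := by
      rw [dp1_phaseMonomial]
      cases j with
      | zero => simp only [Nat.cast_zero, mul_zero, phaseMonomial_zero, Dpow1_zero_left]
      | succ j => exact ih _ _ _ (by omega) _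
    simp only [Dpow1, hq, hp, sub_zero]

theorem Nat.mul_descFactorial_pred (m k : ℕ) :
    m * (m - 1).descFactorial k = m.descFactorial (k + 1) := by
  cases m with
  | zero => simp
  | succ m => rw [Nat.succ_descFactorial_succ, Nat.add_sub_cancel]

/-- Only one term of the binomial expansion of `D_ω^k` survives when `k` equals the degree of the
left argument. -/
theorem Dpow1_phaseMonomial_of_eq (k : ℕ) (c d : ℝ) (i j r s : ℕ) (h : i + j = k)
    (x : ℝ × ℝ) :
    Dpow1 k (phaseMonomial c i j) (phaseMonomial d r s) x =
      c * d * (-1) ^ j * k.factorial * r.descFactorial j * s.descFactorial i *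
        (x.1 ^ (r - j) * x.2 ^ (s - i)) := by
  induction k generalizing c d i j r s with
  | zero =>
    obtain ⟨rfl, rfl⟩ : i = 0 ∧ j = 0 := by omega
    simp [Dpow1, phaseMonomial]
    ring
  | succ k ih =>
    have hq : Dpow1 k (dq1 (phaseMonomial c i j)) (dp1 (phaseMonomial d r s)) x =
        i * (c * d * (-1) ^ j * k.factorial * r.descFactorial j * s.descFactorial i *
          (x.1 ^ (r - j) * x.2 ^ (s - i))) := by
      rw [dq1_phaseMonomial, dp1_phaseMonomial]
      cases i with
      | zero => simp only [Nat.cast_zero, mul_zero, zero_mul, phaseMonomial_zero, Dpow1_zero_left]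
      | succ i =>
        rw [Nat.add_sub_cancel, ih _ _ _ _ _ _ (by omega), ← Nat.mul_descFactorial_pred s i,
          show s - 1 - i = s - (i + 1) by omega]
        push_cast
        ring
    have hp : Dpow1 k (dp1 (phaseMonomial c i j)) (dq1 (phaseMonomial d r s)) x =
        -(j * (c * d * (-1) ^ j * k.factorial * r.descFactorial j * s.descFactorial i *
          (x.1 ^ (r - j) * x.2 ^ (s - i)))) := by
      rw [dq1_phaseMonomial, dp1_phaseMonomial]
      cases j with
      | zero =>
        simp only [Nat.cast_zero, mul_zero, zero_mul, neg_zero, phaseMonomial_zero,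
          Dpow1_zero_left]
      | succ j =>
        rw [Nat.add_sub_cancel, ih _ _ _ _ _ _ (by omega), ← Nat.mul_descFactorial_pred r j,
          show r - 1 - j = r - (j + 1) by omega]
        push_cast
        ring
    have hk : ((k + 1 : ℕ) : ℝ) = i + j := by exact_mod_cast h.symm
    simp only [Dpow1, hq, hp, Nat.factorial_succ, Nat.cast_mul, hk]
    ring

/-- The Poisson bracket of a differentiable function with its square vanishes. -/
theorem Dpow1_one_sq (f : ℝ × ℝ → ℝ) (hf : Differentiable ℝ f) :
    Dpow1 1 f (fun x => f x ^ 2) = fun _ => 0 := by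
  funext x
  simp only [Dpow1, dq1, dp1, ((hf x).hasFDerivAt.pow 2).fderiv]
  simp
  ring

/-- There are functions with vanishing Poisson bracket but nonvanishing generalized Moyal
bracket: if `n ≥ 1` is the smallest index with `a_n ≠ 0` among `a₁, a₂, …`, then for
`f(q,p) = q^n p^{n+1}` one has `{f, f²} = 0` identically, yet
`⟦f, f²⟧ = a_n ħ^{2n} (f D_ω^{2n+1} f²)` is not identically zero. -/
theorem statement9 (hbar : ℝ) (hhbar : 0 < hbar) (a : ℕ → ℝ) (N₀ : ℕ)
    (ha0 : a 0 = 1) (haN : ∀ k, N₀ < k → a k = 0)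
    (n : ℕ) (hn : 1 ≤ n) (han : a n ≠ 0) (hmin : ∀ m, 1 ≤ m → m < n → a m = 0) :
    Dpow1 1 (fun x => x.1 ^ n * x.2 ^ (n + 1))
        (fun x => (x.1 ^ n * x.2 ^ (n + 1)) ^ 2) = (fun _ => 0) ∧
      gmb1 a hbar N₀ (fun x => x.1 ^ n * x.2 ^ (n + 1))
          (fun x => (x.1 ^ n * x.2 ^ (n + 1)) ^ 2)
        = (fun x => a n * hbar ^ (2 * n) *
            Dpow1 (2 * n + 1) (fun y => y.1 ^ n * y.2 ^ (n + 1))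
              (fun y => (y.1 ^ n * y.2 ^ (n + 1)) ^ 2) x) ∧
      gmb1 a hbar N₀ (fun x => x.1 ^ n * x.2 ^ (n + 1))
          (fun x => (x.1 ^ n * x.2 ^ (n + 1)) ^ 2) ≠ (fun _ => 0) := by
  have hf : (fun x : ℝ × ℝ => x.1 ^ n * x.2 ^ (n + 1)) = phaseMonomial 1 n (n + 1) := by
    funext x
    simp [phaseMonomial]
  have hg : (fun x : ℝ × ℝ => (x.1 ^ n * x.2 ^ (n + 1)) ^ 2) =
      phaseMonomial 1 (2 * n) (2 * n + 2) := by
    funext x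
    simp only [phaseMonomial]
    ring
  have hpoisson : Dpow1 1 (fun x => x.1 ^ n * x.2 ^ (n + 1))
      (fun x => (x.1 ^ n * x.2 ^ (n + 1)) ^ 2) = fun _ => 0 :=
    Dpow1_one_sq (fun x => x.1 ^ n * x.2 ^ (n + 1)) (by fun_prop)
  have hmoyal : gmb1 a hbar N₀ (fun x => x.1 ^ n * x.2 ^ (n + 1))
        (fun x => (x.1 ^ n * x.2 ^ (n + 1)) ^ 2)
      = (fun x => a n * hbar ^ (2 * n) *
          Dpow1 (2 * n + 1) (fun y => y.1 ^ n * y.2 ^ (n + 1))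
            (fun y => (y.1 ^ n * y.2 ^ (n + 1)) ^ 2) x) := by
    funext x
    refine Finset.sum_eq_single n (fun m _ hmn => ?_) (fun hmem => ?_)
    · rcases Nat.eq_zero_or_pos m with rfl | hm
      · simp only [Nat.zero_add, hpoisson, mul_zero]
      · rcases lt_or_gt_of_ne hmn with hlt | hgt
        · simp [hmin m hm hlt]
        · rw [hf, Dpow1_phaseMonomial_of_lt _ _ _ _ (by omega), mul_zero]
    · exact absurd (haN n (by simpa using hmem)) han
  refine ⟨hpoisson, hmoyal, fun hzero => ?_⟩
  have h := congrFun (hmoyal.symm.trans hzero) (1, 1)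
  rw [hf, hg] at h
  simp only [Dpow1_phaseMonomial_of_eq (2 * n + 1) 1 1 n (n + 1) (2 * n) (2 * n + 2) (by omega)]
    at h
  simp only [one_pow, mul_one, mul_eq_zero, pow_eq_zero_iff', Nat.cast_eq_zero,
    Nat.descFactorial_eq_zero_iff_lt, han, hhbar.ne', Nat.factorial_ne_zero] at h
  norm_num at h
  omega
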